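/- Let G be a connected simple graph on n vertices whose number of edges |E| satisfies n ∤ 2|E| (non-integer average degree). Then there exists a finite sequence of graphs G = G_0, G_1, …, G_T such that each G_{t+1} is obtained from G_t by an r1-rewiring (deleting an edge {i,h} and adding an edge {j,h} for distinct vertices i, j, h with i~j, i~h, ¬j~h and deg_{G_t}(i) > deg_{G_t}(j)), and G_T satisfies Δ(G_T) − δ(G_T) = 1. -/

import Mathlib

open SimpleGraph
open scoped Classical

/-- One application of the degree-balancing rewiring rule r1: for distinct vertices
`i, j, h` with `i ~ j`, `i ~ h`, `¬ j ~ h` and `deg i > deg j`, delete the edge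
`{i,h}` and add the edge `{j,h}`. -/
def R1Step {V : Type*} [Fintype V] (G G' : SimpleGraph V) : Prop :=
  ∃ i j h : V, i ≠ j ∧ i ≠ h ∧ j ≠ h ∧
    G.Adj i j ∧ G.Adj i h ∧ ¬ G.Adj j h ∧ G.degree j < G.degree i ∧
    G' = G.deleteEdges {s(i, h)} ⊔ SimpleGraph.fromEdgeSet {s(j, h)}

/-- The graph obtained from `G` by replacing the edge `{i, h}` with the edge `{j, h}`. -/
def rewire {V : Type*} (G : SimpleGraph V) (i j h : V) : SimpleGraph V :=
  G.deleteEdges {s(i, h)} ⊔ SimpleGraph.fromEdgeSet {s(j, h)}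

section Rewire

variable {V : Type*} {G : SimpleGraph V} {i j h : V}

theorem rewire_adj (a b : V) :
    (rewire G i j h).Adj a b ↔
      (G.Adj a b ∧ ¬ (a = i ∧ b = h ∨ a = h ∧ b = i)) ∨
        ((a = j ∧ b = h ∨ a = h ∧ b = j) ∧ a ≠ b) := by
  simp [rewire, SimpleGraph.deleteEdges_adj]

theorem connected_rewire (hG : G.Connected) (hij : i ≠ j) (hjh : j ≠ h)
    (adj_ij : G.Adj i j) : (rewire G i j h).Connected := by
  have := hG.nonempty
  have reach_ih : (rewire G i j h).Reachable i h :=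
    (SimpleGraph.Adj.reachable ((rewire_adj i j).2 (by grind))).trans
      (SimpleGraph.Adj.reachable ((rewire_adj j h).2 (by grind)))
  have reach_adj : ∀ a b, G.Adj a b → (rewire G i j h).Reachable a b := by
    intro a b hab
    by_cases hb : a = i ∧ b = h ∨ a = h ∧ b = i
    · rcases hb with ⟨rfl, rfl⟩ | ⟨rfl, rfl⟩
      · exact reach_ih
      · exact reach_ih.symm
    · exact SimpleGraph.Adj.reachable ((rewire_adj a b).2 (Or.inl ⟨hab, hb⟩))
  refine ⟨fun u v => ?_⟩
  obtain ⟨p⟩ := hG.preconnected u v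
  induction p with
  | nil => exact SimpleGraph.Reachable.refl _
  | cons hab _ ih => exact (reach_adj _ _ hab).trans ih

variable [Fintype V]

theorem degree_rewire_left (hij : i ≠ j) (hih : i ≠ h) (adj_ih : G.Adj i h) :
    (rewire G i j h).degree i + 1 = G.degree i := by
  have : (rewire G i j h).neighborFinset i = (G.neighborFinset i).erase h := by
    ext b
    simp only [SimpleGraph.mem_neighborFinset, rewire_adj, Finset.mem_erase]
    grind
  rw [← SimpleGraph.card_neighborFinset_eq_degree, ← SimpleGraph.card_neighborFinset_eq_degree,
    this, Finset.card_erase_add_one (by simpa using adj_ih)]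

theorem degree_rewire_right (hij : i ≠ j) (hjh : j ≠ h) (not_adj : ¬ G.Adj j h) :
    (rewire G i j h).degree j = G.degree j + 1 := by
  have : (rewire G i j h).neighborFinset j = insert h (G.neighborFinset j) := by
    ext b
    simp only [SimpleGraph.mem_neighborFinset, rewire_adj, Finset.mem_insert]
    grind
  rw [← SimpleGraph.card_neighborFinset_eq_degree, ← SimpleGraph.card_neighborFinset_eq_degree,
    this, Finset.card_insert_of_notMem (by simpa using not_adj)]

theorem degree_rewire_of_ne (hjh : j ≠ h) (adj_ih : G.Adj i h)
    (not_adj : ¬ G.Adj j h) {v : V} (hvi : v ≠ i) (hvj : v ≠ j) :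
    (rewire G i j h).degree v = G.degree v := by
  rw [← SimpleGraph.card_neighborFinset_eq_degree, ← SimpleGraph.card_neighborFinset_eq_degree]
  by_cases hvh : v = h
  · subst hvh
    have : (rewire G i j v).neighborFinset v = insert j ((G.neighborFinset v).erase i) := by
      ext b
      simp only [SimpleGraph.mem_neighborFinset, rewire_adj, Finset.mem_insert, Finset.mem_erase]
      grind
    rw [this, Finset.card_insert_of_notMem (by simp [G.adj_comm v j, not_adj]),
      Finset.card_erase_add_one (by simpa using adj_ih.symm)]
  · congr 1
    ext b
    simp only [SimpleGraph.mem_neighborFinset, rewire_adj]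
    grind

theorem exists_adj_not_adj_of_degree_lt (adj_ij : G.Adj i j) (hlt : G.degree j < G.degree i) :
    ∃ h, i ≠ h ∧ j ≠ h ∧ G.Adj i h ∧ ¬ G.Adj j h := by
  have hcard : ((G.neighborFinset j).erase i).card < ((G.neighborFinset i).erase j).card := by
    have h₁ := Finset.card_erase_add_one (s := G.neighborFinset j) (a := i)
      (by simpa using adj_ij.symm)
    have h₂ := Finset.card_erase_add_one (s := G.neighborFinset i) (a := j) (by simpa using adj_ij)
    rw [SimpleGraph.card_neighborFinset_eq_degree] at h₁ h₂
    omega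
  obtain ⟨h, hmem, hnot⟩ := Finset.exists_mem_notMem_of_card_lt_card hcard
  simp only [Finset.mem_erase, SimpleGraph.mem_neighborFinset] at hmem hnot
  exact ⟨h, hmem.2.ne, hmem.1.symm, hmem.2, fun hjh => hnot ⟨hmem.2.ne.symm, hjh⟩⟩

end Rewire

theorem sum_comp_add_eq_of_eq_off_pair {V : Type*} [Fintype V] (f : ℕ → ℕ) {d d' : V → ℕ}
    {i j : V} (hij : i ≠ j) (hd : ∀ v, v ≠ i → v ≠ j → d' v = d v) :
    ∑ v, f (d' v) + (f (d i) + f (d j)) = ∑ v, f (d v) + (f (d' i) + f (d' j)) := by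
  have split : ∀ g : V → ℕ, ∑ v, g v = g i + (g j + ∑ v ∈ (Finset.univ.erase i).erase j, g v) := by
    intro g
    rw [Finset.add_sum_erase _ _ (by simp [hij.symm]), Finset.add_sum_erase _ _ (by simp)]
  rw [split (fun v => f (d' v)), split (fun v => f (d v)),
    Finset.sum_congr rfl fun v hv => ?_]
  · ring
  · simp only [Finset.mem_erase] at hv
    rw [hd v hv.2.1 hv.1]

/-- Along a path whose initial degree exceeds its final degree by at least two, r1-rewirings
can push the excess until the sum of squared degrees drops. -/
theorem exists_reflTransGen_sum_sq_lt {V : Type*} [Fintype V] (G : SimpleGraph V)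
    (hG : G.Connected) {u v : V} (p : G.Walk u v) (hp : p.IsPath)
    (hdeg : G.degree v + 2 ≤ G.degree u) :
    ∃ G' : SimpleGraph V, Relation.ReflTransGen R1Step G G' ∧ G'.Connected ∧
      ∑ x, G'.degree x = ∑ x, G.degree x ∧
      ∑ x, G'.degree x ^ 2 < ∑ x, G.degree x ^ 2 := by
  induction hk : p.length generalizing G u v with
  | zero =>
    obtain rfl := SimpleGraph.Walk.eq_of_length_eq_zero hk
    omega
  | succ k ih =>
    cases p with
    | nil => simp at hk
    | @cons _ w _ adj_uw q =>
      rw [SimpleGraph.Walk.cons_isPath_iff] at hp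
      have hqk : q.length = k := by simpa using hk
      by_cases hw : G.degree v + 2 ≤ G.degree w
      · exact ih G hG q hp.1 hw hqk
      obtain ⟨h, huh, hwh, adj_uh, not_adj⟩ :=
        exists_adj_not_adj_of_degree_lt adj_uw (by omega : G.degree w < G.degree u)
      have huw := adj_uw.ne
      have hstep : R1Step G (rewire G u w h) :=
        ⟨u, w, h, huw, huh, hwh, adj_uw, adj_uh, not_adj, by omega, rfl⟩
      have hconn := connected_rewire hG huw hwh adj_uw
      have hdu := degree_rewire_left huw huh adj_uh
      have hdw := degree_rewire_right huw hwh not_adj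
      have hne : ∀ x, x ≠ u → x ≠ w → (rewire G u w h).degree x = G.degree x :=
        fun x hxu hxw => degree_rewire_of_ne hwh adj_uh not_adj hxu hxw
      have hsum := sum_comp_add_eq_of_eq_off_pair id huw hne
      have hsq := sum_comp_add_eq_of_eq_off_pair (· ^ 2) huw hne
      simp only [id] at hsum hsq
      have hsum' : ∑ x, (rewire G u w h).degree x = ∑ x, G.degree x := by omega
      rw [← hdu, hdw] at hsq
      by_cases hlt : G.degree w + 2 ≤ G.degree u
      · exact ⟨_, .single hstep, hconn, hsum', by nlinarith⟩
      have hvu : v ≠ u := by rintro rfl; omega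
      have hvw : v ≠ w := by
        rintro rfl
        omega
      have hq : ∀ e ∈ q.edges, e ∈ (rewire G u w h).edgeSet := by
        intro e he
        induction e with
        | h a b =>
          have ha := q.fst_mem_support_of_mem_edges he
          have hb := q.snd_mem_support_of_mem_edges he
          exact (rewire_adj a b).2 (Or.inl ⟨q.adj_of_mem_edges he, by grind⟩)
      have hdv := hne v hvu hvw
      obtain ⟨G', hreach, hconn', hsumG', hsqG'⟩ :=
        ih _ hconn (q.transfer _ hq) (hp.1.transfer hq) (by omega) (by simpa using hqk)
      refine ⟨G', .head hstep hreach, hconn', hsumG'.trans hsum', hsqG'.trans_le ?_⟩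
      have : (rewire G u w h).degree u = G.degree w := by omega
      rw [this] at hsq
      omega

theorem exists_reflTransGen_degree_le_add_one {V : Type*} [Fintype V] (G : SimpleGraph V)
    (hG : G.Connected) :
    ∃ G' : SimpleGraph V, Relation.ReflTransGen R1Step G G' ∧
      ∑ x, G'.degree x = ∑ x, G.degree x ∧ ∀ u v, G'.degree u ≤ G'.degree v + 1 := by
  induction hs : ∑ x, G.degree x ^ 2 using Nat.strong_induction_on generalizing G with
  | h s ih =>
    by_cases hbal : ∀ u v, G.degree u ≤ G.degree v + 1
    · exact ⟨G, .refl, rfl, hbal⟩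
    push Not at hbal
    obtain ⟨u, v, huv⟩ := hbal
    obtain ⟨p, hp⟩ := (hG.preconnected u v).exists_isPath
    obtain ⟨G₁, hreach₁, hconn₁, hsum₁, hsq₁⟩ := exists_reflTransGen_sum_sq_lt G hG p hp huv
    obtain ⟨G₂, hreach₂, hsum₂, hbal₂⟩ := ih _ (hs ▸ hsq₁) G₁ hconn₁ rfl
    exact ⟨G₂, hreach₁.trans hreach₂, hsum₂.trans hsum₁, hbal₂⟩

/-- **Theorem 1, non-integer case.** A connected graph whose average degree
`2|E|/n` is not an integer can be transformed by a finite sequence of r1-rewirings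
into a graph whose degree range `Δ − δ` equals `1`. -/
theorem r1_reaches_degree_range_one {V : Type*} [Fintype V] (G : SimpleGraph V)
    (hG : G.Connected)
    (hndvd : ¬ (Fintype.card V ∣ 2 * G.edgeFinset.card)) :
    ∃ G' : SimpleGraph V, Relation.ReflTransGen R1Step G G' ∧
      G'.maxDegree - G'.minDegree = 1 := by
  have := hG.nonempty
  obtain ⟨G', hreach, hsum, hbal⟩ := exists_reflTransGen_degree_le_add_one G hG
  refine ⟨G', hreach, ?_⟩
  obtain ⟨u, hu⟩ := G'.exists_maximal_degree_vertex
  obtain ⟨v, hv⟩ := G'.exists_minimal_degree_vertex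
  have hle := hbal u v
  have hne : G'.minDegree ≠ G'.maxDegree := by
    intro heq
    apply hndvd
    have hconst : ∀ x, G'.degree x = G'.maxDegree := fun x =>
      le_antisymm (G'.degree_le_maxDegree x) (heq ▸ G'.minDegree_le_degree x)
    rw [← G.sum_degrees_eq_twice_card_edges, ← hsum]
    simp [hconst]
  have hmin := G'.minDegree_le_degree u
  omega
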